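/- arXiv:1911.00746 — 8 statements merged into one kernel-verified Lean document; each statement's English description precedes it below -/
import Mathlib

section
/- For every positive integer n, the uniqueness conjecture fails for the graph T_n: there exist two vertices of the binary graph G(S_n(0), S_n(1)) reachable from the root (S_n(0), S_n(0)⊕S_n(1), S_n(1)) by finite sequences of the moves L and R, whose images under χ are two distinct integer triples that have the same largest element (and in each triple the shared value is the largest entry). -/
/-- The continuant `K(a₁,…,aₖ)` of a finite sequence of integers. -/
def continuant : List ℤ → ℤ
  | [] => 1
  | [a] => a
  | a :: b :: t => a * continuant (b :: t) + continuant t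

/-- The integer sine `K̆(α)`: the continuant of `α` with its last entry removed. -/
def intSine (l : List ℤ) : ℤ := continuant l.dropLast

abbrev Triple := List ℤ × List ℤ × List ℤ

/-- The move `L(α,γ,β) = (α, α⊕γ, γ)`. -/
def Lmove (v : Triple) : Triple := (v.1, v.1 ++ v.2.1, v.2.1)

/-- The move `R(α,γ,β) = (γ, γ⊕β, β)`. -/
def Rmove (v : Triple) : Triple := (v.2.1, v.2.1 ++ v.2.2, v.2.2)

/-- One edge step in the binary graph. -/
def GStep (v w : Triple) : Prop := w = Lmove v ∨ w = Rmove v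

/-- Reachability by a finite sequence of moves `L` and `R`. -/
def Reach : Triple → Triple → Prop := Relation.ReflTransGen GStep

/-- `χ(α,γ,β) = (K̆ α, K̆ γ, K̆ β)`. -/
def chi (v : Triple) : ℤ × ℤ × ℤ := (intSine v.1, intSine v.2.1, intSine v.2.2)

/-- `S_n(0) = (n·a_n, n·a_n)` where `a_n = n² + 3`. -/
def S0 (n : ℤ) : List ℤ := [n * (n ^ 2 + 3), n * (n ^ 2 + 3)]

/-- `S_n(1) = (n·b_n, n·b_n)` where `b_n = n⁴ + 5n² + 5`. -/
def S1 (n : ℤ) : List ℤ := [n * (n ^ 4 + 5 * n ^ 2 + 5), n * (n ^ 4 + 5 * n ^ 2 + 5)]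

/-- The root of the binary graph `G(S_n(0), S_n(1))`. -/
def rootT (n : ℤ) : Triple := (S0 n, S0 n ++ S1 n, S1 n)

theorem continuant_pos : ∀ l : List ℤ, (∀ x ∈ l, 0 < x) → 0 < continuant l
  | [], _ => by simp [continuant]
  | [a], h => by simpa [continuant] using h
  | a :: b :: t, h => by
    have ha : 0 < a := h a (by simp)
    have h1 := continuant_pos (b :: t) fun x hx => h x (List.mem_cons_of_mem _ hx)
    have h2 := continuant_pos t fun x hx => h x (by simp [hx])
    simp only [continuant]
    positivity

theorem continuant_le_cons (a : ℤ) (l : List ℤ) (ha : 0 < a) (h : ∀ x ∈ l, 0 < x) :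
    continuant l ≤ continuant (a :: l) := by
  cases l with
  | nil => simpa [continuant] using Int.add_one_le_of_lt ha
  | cons b t =>
    have h1 := continuant_pos (b :: t) h
    have h2 := continuant_pos t fun x hx => h x (by simp [hx])
    simp only [continuant]
    nlinarith

theorem continuant_le_append_left (l r : List ℤ) (hl : ∀ x ∈ l, 0 < x) (hr : ∀ x ∈ r, 0 < x) :
    continuant r ≤ continuant (l ++ r) := by
  induction l with
  | nil => simp
  | cons a t ih =>
    refine (ih fun x hx => hl x (by simp [hx])).trans
      (continuant_le_cons a (t ++ r) (hl a (by simp)) fun x hx => ?_)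
    rcases List.mem_append.1 hx with hx | hx
    · exact hl x (by simp [hx])
    · exact hr x hx

theorem continuant_le_append_right : ∀ l r : List ℤ, (∀ x ∈ l, 0 < x) → (∀ x ∈ r, 0 < x) →
    continuant l ≤ continuant (l ++ r)
  | [], r, _, hr => by
    have := continuant_pos r hr
    simp only [continuant, List.nil_append]
    lia
  | [a], [], _, _ => by simp
  | [a], b :: t, hl, hr => by
    have ha : 0 < a := hl a (by simp)
    have h1 := continuant_pos (b :: t) hr
    have h2 := continuant_pos t fun x hx => hr x (by simp [hx])
    simp only [continuant, List.cons_append, List.nil_append]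
    nlinarith
  | a :: b :: t, r, hl, hr => by
    have ha : 0 < a := hl a (by simp)
    have h1 := continuant_le_append_right (b :: t) r (fun x hx => hl x (by simp [hx])) hr
    have h2 := continuant_le_append_right t r (fun x hx => hl x (by simp [hx])) hr
    simp only [continuant, List.cons_append] at h1 h2 ⊢
    nlinarith

theorem intSine_le_append_left (l r : List ℤ) (hl : ∀ x ∈ l, 0 < x) (hr : ∀ x ∈ r, 0 < x)
    (hne : r ≠ []) : intSine r ≤ intSine (l ++ r) := by
  rw [intSine, intSine, List.dropLast_append_of_ne_nil hne]
  exact continuant_le_append_left _ _ hl fun x hx => hr x (List.mem_of_mem_dropLast hx)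

theorem intSine_le_append_right (l r : List ℤ) (hl : ∀ x ∈ l, 0 < x) (hr : ∀ x ∈ r, 0 < x) :
    intSine l ≤ intSine (l ++ r) := by
  rcases eq_or_ne r [] with rfl | hne
  · simp
  rw [intSine, intSine, List.dropLast_append_of_ne_nil hne]
  calc continuant l.dropLast
      ≤ continuant (l.dropLast ++ l.drop (l.length - 1)) :=
        continuant_le_append_right _ _ (fun x hx => hl x (List.mem_of_mem_dropLast hx))
          fun x hx => hl x (List.mem_of_mem_drop hx)
    _ = continuant l := by rw [List.dropLast_eq_take, List.take_append_drop]
    _ ≤ _ := continuant_le_append_right _ _ hl fun x hx => hr x (List.mem_of_mem_dropLast hx)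

/-- When the middle sequence is the concatenation of the outer two, its integer sine is the
largest entry of the triple. -/
theorem max_chi_eq (α β : List ℤ) (hα : ∀ x ∈ α, 0 < x) (hβ : ∀ x ∈ β, 0 < x) (hne : β ≠ []) :
    max (chi (α, α ++ β, β)).1 (max (chi (α, α ++ β, β)).2.1 (chi (α, α ++ β, β)).2.2)
      = intSine (α ++ β) := by
  have h1 := intSine_le_append_right α β hα hβ
  have h2 := intSine_le_append_left α β hα hβ hne
  simp only [chi]
  rw [max_eq_left h2, max_eq_right h1]

theorem S0_pos (n : ℤ) (hn : 0 < n) : ∀ x ∈ S0 n, 0 < x := by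
  simp only [S0, List.mem_cons, List.not_mem_nil, or_false, or_self, forall_eq]
  positivity

theorem S1_pos (n : ℤ) (hn : 0 < n) : ∀ x ∈ S1 n, 0 < x := by
  simp only [S1, List.mem_cons, List.not_mem_nil, or_false, or_self, forall_eq]
  positivity

theorem reach_Lmove_iterate (v : Triple) (k : ℕ) : Reach v (Lmove^[k] v) := by
  induction k with
  | zero => exact .refl
  | succ k ih => exact ih.tail (.inl (Function.iterate_succ_apply' _ _ _))

theorem reach_Rmove_iterate (v : Triple) (k : ℕ) : Reach v (Rmove^[k] v) := by
  induction k with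
  | zero => exact .refl
  | succ k ih => exact ih.tail (.inr (Function.iterate_succ_apply' _ _ _))

/-- The coincidence of integer sines: `S₀⁶S₁` and `S₀S₁⁴` have the same integer sine. -/
theorem intSine_coincidence (n : ℤ) :
    intSine (S0 n ++ (S0 n ++ (S0 n ++ (S0 n ++ (S0 n ++ (S0 n ++ S1 n))))))
      = intSine (S0 n ++ S1 n ++ S1 n ++ S1 n ++ S1 n) := by
  simp only [intSine, S0, S1, List.cons_append, List.nil_append, List.dropLast, continuant]
  ring

/-- The uniqueness conjecture fails for every graph `T_n`: there are two vertices of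
`G(S_n(0), S_n(1))` whose images under `χ` are distinct triples sharing the same
largest element. -/
theorem uniqueness_fails (n : ℤ) (hn : 0 < n) :
    ∃ v w : Triple, Reach (rootT n) v ∧ Reach (rootT n) w ∧
      chi v ≠ chi w ∧
      max (chi v).1 (max (chi v).2.1 (chi v).2.2)
        = max (chi w).1 (max (chi w).2.1 (chi w).2.2) := by
  have h0 := S0_pos n hn
  have h1 := S1_pos n hn
  refine ⟨_, _, reach_Lmove_iterate (rootT n) 5, reach_Rmove_iterate (rootT n) 3, ?_, ?_⟩
  · intro h
    have hlt : intSine (S0 n) < intSine (S1 n) := by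
      simp only [intSine, S0, S1, List.dropLast, continuant]
      nlinarith [pow_pos hn 5, pow_pos hn 3]
    have hle := intSine_le_append_left (S0 n ++ S1 n ++ S1 n) (S1 n)
      (by simp only [List.forall_mem_append]; exact ⟨⟨h0, h1⟩, h1⟩) h1 (by simp [S1])
    have heq : intSine (S0 n) = intSine (S0 n ++ S1 n ++ S1 n ++ S1 n) := congrArg Prod.fst h
    lia
  · refine (max_chi_eq (S0 n) (S0 n ++ (S0 n ++ (S0 n ++ (S0 n ++ (S0 n ++ S1 n))))) h0
      (by simp only [List.forall_mem_append]; exact ⟨h0, h0, h0, h0, h0, h1⟩)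
      (by simp [S0])).trans ((intSine_coincidence n).trans
        (max_chi_eq (S0 n ++ S1 n ++ S1 n ++ S1 n) (S1 n) ?_ h1 (by simp [S1])).symm)
    simp only [List.forall_mem_append]
    exact ⟨⟨⟨h0, h1⟩, h1⟩, h1⟩
end

section
/- For all positive integers n and j, K̆(S_n(0)^{5j+1} ⊕ S_n(1)) = K̆(S_n(0) ⊕ S_n(1)^{3j+1}). -/
/-- The matrix `x • M + y` where `M = !![a, 1; 1, 0]`. -/
def continuantLin (a x y : ℤ) : Matrix (Fin 2) (Fin 2) ℤ := !![x * a + y, x; x, y]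

theorem continuantLin_mul (a x y z w : ℤ) :
    continuantLin a x y * continuantLin a z w =
      continuantLin a (x * z * a + x * w + y * z) (x * z + y * w) := by
  simp only [continuantLin, Matrix.mul_fin_two]
  congr! 3 <;> ring_nf

/-- The product of the matrices `!![a, 1; 1, 0]` over the entries `a` of a list. -/
def continuantMatrix (l : List ℤ) : Matrix (Fin 2) (Fin 2) ℤ :=
  (l.map fun a => continuantLin a 1 0).prod

theorem continuantMatrix_append (l m : List ℤ) :
    continuantMatrix (l ++ m) = continuantMatrix l * continuantMatrix m := by
  simp [continuantMatrix]

theorem continuantMatrix_replicate_flatten (k : ℕ) (l : List ℤ) :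
    continuantMatrix (List.replicate k l).flatten = continuantMatrix l ^ k := by
  induction k with
  | zero => simp [continuantMatrix]
  | succ k ih =>
    rw [List.replicate_succ, List.flatten_cons, continuantMatrix_append, ih, pow_succ']

theorem continuantMatrix_pair (a : ℤ) : continuantMatrix [a, a] = continuantLin a a 1 := by
  simp [continuantMatrix, continuantLin_mul]

theorem continuantMatrix_zero_zero (l : List ℤ) : continuantMatrix l 0 0 = continuant l := by
  induction l using continuant.induct with
  | case1 => simp [continuantMatrix, continuant]
  | case2 a => simp [continuantMatrix, continuant, continuantLin]
  | case3 a b t ih₁ ih₂ =>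
    rw [continuant, ← ih₁, ← ih₂]
    simp [continuantMatrix, continuantLin, Matrix.mul_apply, Matrix.vecMul, dotProduct,
      Fin.sum_univ_two]

theorem intSine_eq_continuantMatrix {l : List ℤ} (hl : l ≠ []) :
    intSine l = continuantMatrix l 0 1 := by
  obtain ⟨m, a, rfl⟩ := List.eq_nil_or_concat' l |>.resolve_left hl
  rw [intSine, List.dropLast_concat, continuantMatrix_append, ← continuantMatrix_zero_zero]
  simp [continuantMatrix, continuantLin, Matrix.mul_apply, Fin.sum_univ_two]

theorem exists_continuantMatrix_pow_five_pow_three (n : ℤ) :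
    ∃ t q : ℤ,
      continuantMatrix (S0 n) ^ 5 =
        continuantLin (n * (n ^ 2 + 3)) (t * (n ^ 4 + 3 * n ^ 2 + 1)) q ∧
      continuantMatrix (S1 n) ^ 3 =
        continuantLin (n * (n ^ 4 + 5 * n ^ 2 + 5)) (t * (n ^ 2 + 1)) (q - n * t) := by
  let b := n * (n ^ 4 + 5 * n ^ 2 + 5)
  let t := b * (b ^ 2 + 3) * (n ^ 8 + 9 * n ^ 6 + 26 * n ^ 4 + 24 * n ^ 2 + 1)
  refine ⟨t, (b ^ 2 + 1) ^ 2 + b ^ 2 + n * t, ?_, ?_⟩ <;>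
    simp only [S0, S1, continuantMatrix_pair, pow_succ _ 4, pow_succ _ 3, pow_succ _ 2,
      pow_succ _ 1, pow_one, continuantLin_mul, t, b] <;>
    congr 1 <;> ring

theorem exists_continuantMatrix_pow (n : ℤ) (j : ℕ) :
    ∃ t q : ℤ,
      continuantMatrix (S0 n) ^ (5 * j) =
        continuantLin (n * (n ^ 2 + 3)) (t * (n ^ 4 + 3 * n ^ 2 + 1)) q ∧
      continuantMatrix (S1 n) ^ (3 * j) =
        continuantLin (n * (n ^ 4 + 5 * n ^ 2 + 5)) (t * (n ^ 2 + 1)) (q - n * t) := by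
  obtain ⟨t₁, q₁, h₀, h₁⟩ := exists_continuantMatrix_pow_five_pow_three n
  induction j with
  | zero => exact ⟨0, 1, by simp [continuantLin, Matrix.one_fin_two]⟩
  | succ j ih =>
    obtain ⟨t, q, h₂, h₃⟩ := ih
    refine ⟨t * t₁ * (n ^ 4 + 3 * n ^ 2 + 1) * (n * (n ^ 2 + 3)) + t * q₁ + q * t₁,
      t * t₁ * (n ^ 4 + 3 * n ^ 2 + 1) ^ 2 + q * q₁, ?_, ?_⟩
    · rw [mul_add_one, pow_add, h₂, h₀, continuantLin_mul]
      congr 1 <;> ring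
    · rw [mul_add_one, pow_add, h₃, h₁, continuantLin_mul]
      congr 1 <;> ring

/-- For all positive integers `n` and `j`,
`K̆(S_n(0)^{5j+1} ⊕ S_n(1)) = K̆(S_n(0) ⊕ S_n(1)^{3j+1})`. -/
theorem intSine_pow_eq (n : ℤ) (hn : 0 < n) (j : ℕ) (hj : 0 < j) :
    intSine ((List.replicate (5 * j + 1) (S0 n)).flatten ++ S1 n)
      = intSine (S0 n ++ (List.replicate (3 * j + 1) (S1 n)).flatten) := by
  rw [intSine_eq_continuantMatrix (by simp [S1]), intSine_eq_continuantMatrix (by simp [S0])]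
  obtain ⟨t, q, h₀, h₁⟩ := exists_continuantMatrix_pow n j
  simp only [continuantMatrix_append, continuantMatrix_replicate_flatten]
  rw [pow_succ', pow_succ, h₀, h₁]
  simp only [S0, S1, continuantMatrix_pair, continuantLin, Matrix.mul_fin_two]
  simp only [Matrix.of_apply, Matrix.cons_val]
  ring
end

section
/- For all positive integers n and j, R_n(j) = A_n(10j). -/
/-- `A_n(1) = 1`, `A_n(2) = n(n²+4)`, `A_n(j) = n·A_n(j−1) + A_n(j−2)` for `j > 2`. -/
def A (n : ℤ) : ℕ → ℤ
  | 0 => 0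
  | 1 => 1
  | 2 => n * (n ^ 2 + 4)
  | j + 3 => n * A n (j + 2) + A n (j + 1)

/-- `L_n(1) = K̆(na,na,nb,nb)`, `L_n(2) = K̆(na,na,na,na,nb,nb)`,
`L_n(j) = l_n·L_n(j−1) − L_n(j−2)` for `j > 2`, where `l_n = (n·a_n)² + 2`. -/
def Ln (n : ℤ) : ℕ → ℤ
  | 0 => 0
  | 1 => intSine (S0 n ++ S1 n)
  | 2 => intSine (S0 n ++ S0 n ++ S1 n)
  | j + 3 => ((n * (n ^ 2 + 3)) ^ 2 + 2) * Ln n (j + 2) - Ln n (j + 1)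

/-- `R_n(1) = K̆(na,na,nb,nb)`, `R_n(2) = K̆(na,na,nb,nb,nb,nb)`,
`R_n(j) = r_n·R_n(j−1) − R_n(j−2)` for `j > 2`, where `r_n = (n·b_n)² + 2`. -/
def Rn (n : ℤ) : ℕ → ℤ
  | 0 => 0
  | 1 => intSine (S0 n ++ S1 n)
  | 2 => intSine (S0 n ++ S1 n ++ S1 n)
  | j + 3 => ((n * (n ^ 4 + 5 * n ^ 2 + 5)) ^ 2 + 2) * Rn n (j + 2) - Rn n (j + 1)

/-- Along steps of length ten, `A_n` satisfies the recurrence with trace `r_n = (n·b_n)² + 2`. -/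
theorem A_add_twenty_one (n : ℤ) (k : ℕ) :
    A n (k + 21) =
      ((n * (n ^ 4 + 5 * n ^ 2 + 5)) ^ 2 + 2) * A n (k + 11) - A n (k + 1) := by
  simp only [A]
  generalize A n (k + 1) = x
  generalize A n (k + 2) = y
  ring

theorem Rn_succ_eq_A (n : ℤ) : ∀ j : ℕ, Rn n (j + 1) = A n (10 * (j + 1))
  | 0 => by
    simp [Rn, A, intSine, continuant, S0, S1]
    ring
  | 1 => by
    simp [Rn, A, intSine, continuant, S0, S1]
    ring
  | j + 2 => by
    have h := A_add_twenty_one n (10 * j + 9)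
    have h₁ := Rn_succ_eq_A n (j + 1)
    have h₀ := Rn_succ_eq_A n j
    rw [show 10 * (j + 2 + 1) = 10 * j + 9 + 21 by ring, h, Rn, h₁, h₀]
    rfl

/-- For all positive integers `n` and `j`, `R_n(j) = A_n(10j)`. -/
theorem Rn_eq_A (n : ℤ) (hn : 0 < n) (j : ℕ) (hj : 0 < j) :
    Rn n j = A n (10 * j) := by
  obtain ⟨k, rfl⟩ := Nat.exists_eq_add_of_lt hj
  rw [zero_add]
  exact Rn_succ_eq_A n k
end

section
/- For all positive integers n and j, L_n(j) = A_n(10+6(j−1)), i.e. L_n(j)=A_n(6j+4). -/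
/-- The sequence `A n` satisfies the six-step recurrence whose coefficient is the sixth
Lucas polynomial. -/
theorem A_add_twelve (n : ℤ) (m : ℕ) :
    A n (m + 13) = ((n * (n ^ 2 + 3)) ^ 2 + 2) * A n (m + 7) - A n (m + 1) := by
  simp only [A]
  ring

theorem Ln_one (n : ℤ) : Ln n 1 = A n 10 := by
  simp only [Ln, A, intSine, S0, S1, List.cons_append, List.nil_append, List.dropLast, continuant]
  ring

theorem Ln_two (n : ℤ) : Ln n 2 = A n 16 := by
  simp only [Ln, A, intSine, S0, S1, List.cons_append, List.nil_append, List.dropLast, continuant]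
  ring

theorem Ln_succ_eq_A (n : ℤ) : ∀ j : ℕ, Ln n (j + 1) = A n (6 * j + 10)
  | 0 => Ln_one n
  | 1 => Ln_two n
  | j + 2 => by
    rw [Ln, Ln_succ_eq_A n (j + 1), Ln_succ_eq_A n j]
    exact (A_add_twelve n (6 * j + 9)).symm

/-- For all positive integers `n` and `j`, `L_n(j) = A_n(10 + 6(j−1)) = A_n(6j+4)`. -/
theorem Ln_eq_A (n : ℤ) (hn : 0 < n) (j : ℕ) (hj : 0 < j) :
    Ln n j = A n (6 * j + 4) := by
  obtain ⟨k, rfl⟩ := Nat.exists_eq_add_of_lt hj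
  rw [Nat.zero_add]
  exact Ln_succ_eq_A n k
end

section
/- For all positive integers n and i, L_n(5i+1) = R_n(3i+1). -/
/-- Every fifth term of a sequence with `u (j + 2) = p * u (j + 1) - u j` satisfies the recurrence
with `p` replaced by `p ^ 5 - 5 * p ^ 3 + 5 * p`. -/
theorem recurrence_five {u : ℕ → ℤ} {p : ℤ} (h : ∀ j, u (j + 2) = p * u (j + 1) - u j) (j : ℕ) :
    u (j + 10) = (p ^ 5 - 5 * p ^ 3 + 5 * p) * u (j + 5) - u j := by
  rw [h (j + 8), h (j + 7), h (j + 6), h (j + 5), h (j + 4), h (j + 3), h (j + 2), h (j + 1), h j]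
  ring

/-- Every third term of a sequence with `u (j + 2) = p * u (j + 1) - u j` satisfies the recurrence
with `p` replaced by `p ^ 3 - 3 * p`. -/
theorem recurrence_three {u : ℕ → ℤ} {p : ℤ} (h : ∀ j, u (j + 2) = p * u (j + 1) - u j) (j : ℕ) :
    u (j + 6) = (p ^ 3 - 3 * p) * u (j + 3) - u j := by
  rw [h (j + 4), h (j + 3), h (j + 2), h (j + 1), h j]
  ring

/-- For all positive integers `n` and `i`, `L_n(5i+1) = R_n(3i+1)`. -/
theorem Ln_eq_Rn (n : ℤ) (hn : 0 < n) (i : ℕ) (hi : 0 < i) :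
    Ln n (5 * i + 1) = Rn n (3 * i + 1) := by
  clear hn hi
  induction i using Nat.twoStepInduction with
  | zero => rfl
  | one =>
    simp only [Ln, Rn, S0, S1, intSine, continuant, List.cons_append, List.nil_append,
      List.dropLast]
    ring
  | more i ih₀ ih₁ =>
    have hL := recurrence_five (u := fun j => Ln n (j + 1)) (fun _ => rfl) (5 * i)
    have hR := recurrence_three (u := fun j => Rn n (j + 1)) (fun _ => rfl) (3 * i)
    have hp : ∀ x y : ℤ, x = (n * (n ^ 2 + 3)) ^ 2 + 2 → y = (n * (n ^ 4 + 5 * n ^ 2 + 5)) ^ 2 + 2 →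
        x ^ 5 - 5 * x ^ 3 + 5 * x = y ^ 3 - 3 * y := by
      rintro _ _ rfl rfl
      ring
    rw [hp _ _ rfl rfl] at hL
    exact hL.trans (Eq.trans (congrArg₂ (fun a b => _ * a - b) ih₁ ih₀) hR.symm)
end

section
/- For every positive integer n and every integer m ≥ 13, A_n(m) = z₁·A_n(m−11) + z₂·A_n(m−12), where z₁ = n¹¹+10n⁹+36n⁷+56n⁵+35n³+6n and z₂ = n¹⁰+9n⁸+28n⁶+35n⁴+15n²+1. -/
/-- For every positive integer `n` and `m ≥ 13`,
`A_n(m) = z₁·A_n(m−11) + z₂·A_n(m−12)`. -/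
theorem A_shift_twelve (n : ℤ) (hn : 0 < n) (m : ℕ) (hm : 13 ≤ m) :
    A n m = (n ^ 11 + 10 * n ^ 9 + 36 * n ^ 7 + 56 * n ^ 5 + 35 * n ^ 3 + 6 * n) * A n (m - 11)
      + (n ^ 10 + 9 * n ^ 8 + 28 * n ^ 6 + 35 * n ^ 4 + 15 * n ^ 2 + 1) * A n (m - 12) := by
  obtain ⟨k, rfl⟩ := Nat.exists_eq_add_of_le' hm
  have h (j : ℕ) : A n (j + 3) = n * A n (j + 2) + A n (j + 1) := rfl
  rw [show k + 13 - 11 = k + 2 by lia, show k + 13 - 12 = k + 1 by lia,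
    h (k + 10), h (k + 9), h (k + 8), h (k + 7), h (k + 6), h (k + 5), h (k + 4), h (k + 3),
    h (k + 2), h (k + 1), h k]
  ring
end

section
/- For all positive integers n and j, L_n(j) = K̆(S_n(0)^j ⊕ S_n(1)); that is, the integer sines of the concatenations S_n(0)^j ⊕ S_n(1) satisfy the linear recurrence with coefficient l_n: for j ≥ 3, K̆(S_n(0)^j ⊕ S_n(1)) = l_n · K̆(S_n(0)^{j−1} ⊕ S_n(1)) − K̆(S_n(0)^{j−2} ⊕ S_n(1)). -/
theorem continuant_cons_cons (a b : ℤ) (t : List ℤ) :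
    continuant (a :: b :: t) = a * continuant (b :: t) + continuant t := by
  simp [continuant]

/-- Prepending the pair `(a, a)` acts on continuants by a matrix of determinant `1` and
trace `a² + 2`; this is the resulting Cayley–Hamilton recurrence. -/
theorem continuant_pair_pair (a : ℤ) (w : List ℤ) :
    continuant (a :: a :: a :: a :: w)
      = (a ^ 2 + 2) * continuant (a :: a :: w) - continuant w := by
  cases w with
  | nil => simp only [continuant]; ring
  | cons b t => simp only [continuant_cons_cons]; ring

theorem intSine_append_S1 (n : ℤ) (w : List ℤ) :
    intSine (w ++ S1 n) = continuant (w ++ [n * (n ^ 4 + 5 * n ^ 2 + 5)]) := by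
  simp [intSine, S1]

theorem intSine_S0_replicate_add_two (n : ℤ) (j : ℕ) :
    intSine ((List.replicate (j + 2) (S0 n)).flatten ++ S1 n)
      = ((n * (n ^ 2 + 3)) ^ 2 + 2)
          * intSine ((List.replicate (j + 1) (S0 n)).flatten ++ S1 n)
        - intSine ((List.replicate j (S0 n)).flatten ++ S1 n) := by
  simp only [intSine_append_S1, List.replicate_succ, List.flatten_cons]
  exact continuant_pair_pair _ _

theorem Ln_succ_eq_intSine (n : ℤ) (j : ℕ) :
    Ln n (j + 1) = intSine ((List.replicate (j + 1) (S0 n)).flatten ++ S1 n) := by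
  induction j using Nat.twoStepInduction with
  | zero => simp [Ln]
  | one => simp [Ln, List.replicate_succ]
  | more j ih₁ ih₂ => rw [Ln, ih₁, ih₂, ← intSine_S0_replicate_add_two]

/-- For all positive integers `n` and `j`, `L_n(j) = K̆(S_n(0)^j ⊕ S_n(1))`; that is,
the integer sines of `S_n(0)^j ⊕ S_n(1)` satisfy the linear recurrence with
coefficient `l_n = (n·a_n)² + 2`. -/
theorem Ln_eq_intSine (n : ℤ) (hn : 0 < n) :
    (∀ j : ℕ, 0 < j → Ln n j = intSine ((List.replicate j (S0 n)).flatten ++ S1 n)) ∧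
    (∀ j : ℕ, 3 ≤ j →
      intSine ((List.replicate j (S0 n)).flatten ++ S1 n)
        = ((n * (n ^ 2 + 3)) ^ 2 + 2)
            * intSine ((List.replicate (j - 1) (S0 n)).flatten ++ S1 n)
          - intSine ((List.replicate (j - 2) (S0 n)).flatten ++ S1 n)) := by
  refine ⟨fun j hj => ?_, fun j hj => ?_⟩
  · obtain ⟨k, rfl⟩ := Nat.exists_eq_add_of_lt hj
    simpa using Ln_succ_eq_intSine n k
  · obtain ⟨k, rfl⟩ := Nat.exists_eq_add_of_le' hj
    exact intSine_S0_replicate_add_two n (k + 1)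
end

section
/- For all positive integers n and j, R_n(j) = K̆(S_n(0) ⊕ S_n(1)^j); that is, the integer sines of the concatenations S_n(0) ⊕ S_n(1)^j satisfy the linear recurrence with coefficient r_n: for j ≥ 3, K̆(S_n(0) ⊕ S_n(1)^j) = r_n · K̆(S_n(0) ⊕ S_n(1)^{j−1}) − K̆(S_n(0) ⊕ S_n(1)^{j−2}). -/
theorem continuant_recurrence (A B : ℤ) (l : List ℤ) :
    continuant (A :: A :: B :: B :: B :: B :: B :: l)
      = (B ^ 2 + 2) * continuant (A :: A :: B :: B :: B :: l)
        - continuant (A :: A :: B :: l) := by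
  simp only [continuant]
  ring

theorem intSine_recurrence (n : ℤ) (k : ℕ) :
    intSine (S0 n ++ (List.replicate (k + 3) (S1 n)).flatten)
      = ((n * (n ^ 4 + 5 * n ^ 2 + 5)) ^ 2 + 2)
          * intSine (S0 n ++ (List.replicate (k + 2) (S1 n)).flatten)
        - intSine (S0 n ++ (List.replicate (k + 1) (S1 n)).flatten) := by
  simp only [intSine, S0, S1, List.replicate_succ, List.flatten_cons, List.cons_append,
    List.nil_append, List.dropLast_cons_cons]
  exact continuant_recurrence _ _ _

theorem Rn_succ_eq_intSine (n : ℤ) (k : ℕ) :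
    Rn n (k + 1) = intSine (S0 n ++ (List.replicate (k + 1) (S1 n)).flatten) := by
  induction k using Nat.twoStepInduction with
  | zero => simp [Rn]
  | one => simp [Rn, List.replicate_succ]
  | more k ih₁ ih₂ => rw [intSine_recurrence, ← ih₁, ← ih₂, Rn]

/-- For all positive integers `n` and `j`, `R_n(j) = K̆(S_n(0) ⊕ S_n(1)^j)`; that is,
the integer sines of `S_n(0) ⊕ S_n(1)^j` satisfy the linear recurrence with
coefficient `r_n = (n·b_n)² + 2`. -/
theorem Rn_eq_intSine (n : ℤ) (hn : 0 < n) :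
    (∀ j : ℕ, 0 < j → Rn n j = intSine (S0 n ++ (List.replicate j (S1 n)).flatten)) ∧
    (∀ j : ℕ, 3 ≤ j →
      intSine (S0 n ++ (List.replicate j (S1 n)).flatten)
        = ((n * (n ^ 4 + 5 * n ^ 2 + 5)) ^ 2 + 2)
            * intSine (S0 n ++ (List.replicate (j - 1) (S1 n)).flatten)
          - intSine (S0 n ++ (List.replicate (j - 2) (S1 n)).flatten)) := by
  refine ⟨fun j hj => ?_, fun j hj => ?_⟩
  · obtain ⟨k, rfl⟩ := Nat.exists_eq_add_of_le' hj
    exact Rn_succ_eq_intSine n k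
  · obtain ⟨k, rfl⟩ := Nat.exists_eq_add_of_le' hj
    exact intSine_recurrence n k
end
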